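/- (Lemma 3, worst-case distribution: Bernoulli minimizes the growth rate.) Let c > 1/4, m ∈ [0,1], and let P be any probability measure on [0,1] with mean μ = ∫ x dP(x). Then μ·log(1 + (μ − m)(1 − m)/c) + (1 − μ)·log(1 − (μ − m)·m/c) ≤ ∫ log(1 + (μ − m)(x − m)/c) dP(x); that is, among all distributions on [0,1] with mean μ, the Bernoulli(μ) distribution minimizes the asymptotic growth rate G(c, m, P). -/

import Mathlib

open MeasureTheory

/-- Deviations of two points of `[0,1]` from a third one have product at least `-1/4`. -/
lemma neg_quarter_le_sub_mul_sub {a x m : ℝ} (ha : a ∈ Set.Icc (0 : ℝ) 1)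
    (hx : x ∈ Set.Icc (0 : ℝ) 1) (hm : m ∈ Set.Icc (0 : ℝ) 1) :
    -(1 / 4) ≤ (a - m) * (x - m) := by
  obtain ⟨ha0, ha1⟩ := ha
  obtain ⟨hx0, hx1⟩ := hx
  obtain ⟨hm0, hm1⟩ := hm
  nlinarith [sq_nonneg (a + x - 2 * m), sq_nonneg (a - x)]

lemma one_add_sub_mul_sub_div_pos {c a x m : ℝ} (hc : 1 / 4 < c) (ha : a ∈ Set.Icc (0 : ℝ) 1)
    (hx : x ∈ Set.Icc (0 : ℝ) 1) (hm : m ∈ Set.Icc (0 : ℝ) 1) :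
    0 < 1 + (a - m) * (x - m) / c := by
  have hc0 : 0 < c := by linarith
  have h : -1 < (a - m) * (x - m) / c := by
    rw [lt_div_iff₀ hc0]
    linarith [neg_quarter_le_sub_mul_sub ha hx hm]
  linarith

/-- The chord of the concave function `log` lies below its graph. -/
lemma chord_le_log {A B x : ℝ} (hA : 0 < A) (hB : 0 < B) (hx : x ∈ Set.Icc (0 : ℝ) 1) :
    x * Real.log A + (1 - x) * Real.log B ≤ Real.log (x * A + (1 - x) * B) :=
  strictConcaveOn_log_Ioi.concaveOn.2 hA hB hx.1 (sub_nonneg.2 hx.2) (by ring)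

/-- **Lemma 3, worst-case distribution: Bernoulli minimizes the growth
rate.** For `c > 1/4`, `m ∈ [0,1]`, and any probability measure `P` on `[0,1]` with
mean `μ`,
`μ·log(1 + (μ − m)(1 − m)/c) + (1 − μ)·log(1 − (μ − m)·m/c)
  ≤ ∫ log(1 + (μ − m)(x − m)/c) dP(x)`. -/
theorem bernoulli_minimizes_growth_rate
    (c : ℝ) (hc : 1 / 4 < c) (m : ℝ) (hm : m ∈ Set.Icc (0 : ℝ) 1)
    (P : Measure ℝ) [IsProbabilityMeasure P]
    (hsupp : ∀ᵐ x ∂P, x ∈ Set.Icc (0 : ℝ) 1)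
    (μ : ℝ) (hμ : μ = ∫ x, x ∂P) :
    μ * Real.log (1 + (μ - m) * (1 - m) / c)
        + (1 - μ) * Real.log (1 - (μ - m) * m / c)
      ≤ ∫ x, Real.log (1 + (μ - m) * (x - m) / c) ∂P := by
  have hid : Integrable (fun x : ℝ => x) P :=
    Integrable.of_mem_Icc 0 1 aemeasurable_id hsupp
  have hμI : μ ∈ Set.Icc (0 : ℝ) 1 := by
    rw [hμ]
    exact (convex_Icc 0 1).integral_mem isClosed_Icc hsupp hid
  set A := 1 + (μ - m) * (1 - m) / c with hA
  set B := 1 - (μ - m) * m / c with hB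
  have hApos : 0 < A :=
    one_add_sub_mul_sub_div_pos hc hμI (Set.right_mem_Icc.2 zero_le_one) hm
  have hBpos : 0 < B := by
    have h := one_add_sub_mul_sub_div_pos hc hμI (Set.left_mem_Icc.2 zero_le_one) hm
    rw [hB]
    convert h using 1
    ring
  have hlower : ∀ᵐ x ∂P, x * Real.log A + (1 - x) * Real.log B
      ≤ Real.log (1 + (μ - m) * (x - m) / c) := by
    filter_upwards [hsupp] with x hx
    convert chord_le_log hApos hBpos hx using 2
    rw [hA, hB]
    ring
  have hupper : ∀ᵐ x ∂P, Real.log (1 + (μ - m) * (x - m) / c) ≤ (μ - m) * (x - m) / c := by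
    filter_upwards [hsupp] with x hx
    linarith [Real.log_le_sub_one_of_pos (one_add_sub_mul_sub_div_pos hc hμI hx hm)]
  have hleft : Integrable (fun x : ℝ => x * Real.log A) P := hid.mul_const _
  have hright : Integrable (fun x : ℝ => (1 - x) * Real.log B) P :=
    ((integrable_const 1).sub hid).mul_const _
  have hlin : Integrable (fun x : ℝ => (μ - m) * (x - m) / c) P :=
    ((hid.sub (integrable_const m)).const_mul _).div_const _
  have hlog : Integrable (fun x : ℝ => Real.log (1 + (μ - m) * (x - m) / c)) P :=
    integrable_of_le_of_le (Measurable.aestronglyMeasurable (by fun_prop)) hlower hupper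
      (hleft.add hright) hlin
  calc μ * Real.log A + (1 - μ) * Real.log B
      = ∫ x, (x * Real.log A + (1 - x) * Real.log B) ∂P := by
        rw [integral_add hleft hright, integral_mul_const, integral_mul_const,
          integral_sub (integrable_const 1) hid, ← hμ]
        simp
    _ ≤ ∫ x, Real.log (1 + (μ - m) * (x - m) / c) ∂P :=
        integral_mono_ae (hleft.add hright) hlog hlower
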